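/- arXiv:2012.11491 — 3 statements merged into one kernel-verified Lean document; each statement's English description precedes it below -/
import Mathlib

section
/- Let t0 ≥ 0, σ > 0, τ > 0, and let a, b, g, h : ℝ → ℝ be Lebesgue measurable with 0 ≤ t − g(t) ≤ σ and 0 ≤ t − h(t) ≤ τ for almost every t ≥ t0. Suppose there exist constants a0 ≥ 0, A0 ∈ [0,1), b0 > 0 and B0 > 0 such that for almost every t ≥ t0: a0 ≤ a(t) ≤ A0 and b0 ≤ b(t) ≤ B0, and that τ·B0 + σ·A0·B0²·(1 − a0)/((1 − A0)²·b0) < 1 − A0. Then the neutral equation x'(t) − a(t)x'(g(t)) = −b(t)·x(h(t)) is uniformly exponentially stable for initial times in [t0,∞). -/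
open MeasureTheory Real

/-- The extended derivative: `deriv x t` for `t ≥ s`, the prescribed initial
derivative `ψ t` for `t < s`. -/
noncomputable def Dfun (x ψ : ℝ → ℝ) (s : ℝ) : ℝ → ℝ :=
  fun t => if s ≤ t then deriv x t else ψ t

/-- A function `f : ℝ → ℝ` is (globally) bounded. -/
def Bdd (f : ℝ → ℝ) : Prop := ∃ C : ℝ, ∀ u : ℝ, |f u| ≤ C

/-- `x` is a solution on `[s,∞)` of the neutral equation
`x'(t) - a(t) x'(g(t)) = -b(t) x(h(t))` with initial data `(φ, ψ)`. -/
def IsNeutralSolution1 (a b g h : ℝ → ℝ) (s : ℝ) (φ ψ x : ℝ → ℝ) : Prop :=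
  (∀ t ≤ s, x t = φ t) ∧
  (∀ t, s ≤ t → DifferentiableAt ℝ x t) ∧
  (∀ t1, s ≤ t1 → ∃ C : ℝ, ∀ t ∈ Set.Icc s t1, |deriv x t| ≤ C) ∧
  (∀ᵐ t : ℝ ∂volume, s ≤ t →
    Dfun x ψ s t - a t * Dfun x ψ s (g t) = -(b t * x (h t)))

/-- Uniform exponential stability of the neutral equation
`x'(t) - a(t) x'(g(t)) = -b(t) x(h(t))` for initial times in `[t0,∞)`. -/
def UnifExpStable1 (a b g h : ℝ → ℝ) (t0 : ℝ) : Prop :=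
  ∃ M > (0:ℝ), ∃ γ > (0:ℝ), ∀ s, t0 ≤ s → ∀ φ ψ x : ℝ → ℝ, Bdd φ → Bdd ψ →
    IsNeutralSolution1 a b g h s φ ψ x →
    ∀ t, s ≤ t →
      |x t| ≤ M * Real.exp (-γ * (t - s)) * ⨆ u : {u : ℝ // u ≤ s}, (|φ u.1| + |ψ u.1|)


lemma ae_to_all (x U : ℝ → ℝ) (p q C : ℝ) (hpq : p < q)
    (hd : ∀ t ∈ Set.Icc p q, DifferentiableAt ℝ x t)
    (hC : ∀ t ∈ Set.Icc p q, |deriv x t| ≤ C)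
    (hU : ContinuousOn U (Set.Icc p q))
    (hae : ∀ᵐ t : ℝ ∂volume, t ∈ Set.Icc p q → deriv x t ≤ U t) :
    ∀ t ∈ Set.Icc p q, deriv x t ≤ U t := by
  have hUi : IntervalIntegrable U volume p q := by
    apply ContinuousOn.intervalIntegrable
    rwa [Set.uIcc_of_le hpq.le]
  have hdi : IntervalIntegrable (deriv x) volume p q := by
    rw [intervalIntegrable_iff_integrableOn_Icc_of_le hpq.le]
    apply Measure.integrableOn_of_bounded (M := C)
    · simp
    · exact (measurable_deriv x).aestronglyMeasurable
    · filter_upwards [ae_restrict_mem measurableSet_Icc] with t ht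
      exact hC t ht
  set G : ℝ → ℝ := fun t => (∫ u in p..t, U u) - x t with hG
  have hmono : MonotoneOn G (Set.Icc p q) := by
    intro u hu v hv huv
    have hsub : Set.uIcc u v ⊆ Set.uIcc p q := by
      rw [Set.uIcc_of_le huv, Set.uIcc_of_le hpq.le]
      exact Set.Icc_subset_Icc hu.1 hv.2
    have hsub' : ∀ c ∈ Set.Icc p q, Set.uIcc p c ⊆ Set.uIcc p q := by
      intro c hc
      rw [Set.uIcc_of_le hc.1, Set.uIcc_of_le hpq.le]
      exact Set.Icc_subset_Icc le_rfl hc.2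
    have h1 : ∫ y in u..v, deriv x y = x v - x u := by
      apply intervalIntegral.integral_deriv_eq_sub
      · intro y hy
        apply hd
        have := hsub hy
        rwa [Set.uIcc_of_le hpq.le] at this
      · exact hdi.mono_set hsub
    have h2 : (∫ y in p..v, U y) - (∫ y in p..u, U y) = ∫ y in u..v, U y :=
      intervalIntegral.integral_interval_sub_left (hUi.mono_set (hsub' v hv))
        (hUi.mono_set (hsub' u hu))
    have h3 : ∫ y in u..v, deriv x y ≤ ∫ y in u..v, U y := by
      apply intervalIntegral.integral_mono_ae_restrict huv (hdi.mono_set hsub) (hUi.mono_set hsub)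
      filter_upwards [ae_restrict_mem measurableSet_Icc, ae_restrict_of_ae hae] with y hy hy2
      exact hy2 ⟨hu.1.trans hy.1, hy.2.trans hv.2⟩
    simp only [hG]
    linarith
  intro t ht
  have hder : HasDerivWithinAt G (U t - deriv x t) (Set.Icc p q) t := by
    apply HasDerivWithinAt.sub
    · have : Fact (t ∈ Set.Icc p q) := ⟨ht⟩
      apply intervalIntegral.integral_hasDerivWithinAt_right (s := Set.Icc p q) (t := Set.Icc p q)
      · apply hUi.mono_set
        rw [Set.uIcc_of_le ht.1, Set.uIcc_of_le hpq.le]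
        exact Set.Icc_subset_Icc le_rfl ht.2
      · exact ⟨Set.Icc p q, self_mem_nhdsWithin,
          hU.aestronglyMeasurable measurableSet_Icc⟩
      · exact hU t ht
    · exact (hd t ht).hasDerivAt.hasDerivWithinAt
  have h4 := hmono.derivWithin_nonneg (x := t)
  rw [hder.derivWithin (uniqueDiffOn_Icc hpq t ht)] at h4
  linarith

lemma sup_contr (F : ℝ → ℝ) (p q c ρ M0 : ℝ) (hpq : p ≤ q) (hρ0 : 0 ≤ ρ) (hρ : ρ < 1) (hc : 0 ≤ c)
    (hb : ∀ t ∈ Set.Icc p q, F t ≤ M0)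
    (hstep : ∀ E, 0 ≤ E → (∀ t ∈ Set.Icc p q, F t ≤ E) → ∀ t ∈ Set.Icc p q, F t ≤ c + ρ * E) :
    ∀ t ∈ Set.Icc p q, F t ≤ c / (1 - ρ) := by
  have hbdd : BddAbove (F '' Set.Icc p q) := ⟨M0, by rintro _ ⟨t, ht, rfl⟩; exact hb t ht⟩
  set E := max (sSup (F '' Set.Icc p q)) 0 with hE
  have h1 : ∀ t ∈ Set.Icc p q, F t ≤ E := fun t ht =>
    (le_csSup hbdd ⟨t, ht, rfl⟩).trans (le_max_left _ _)
  have hE0 : 0 ≤ E := le_max_right _ _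
  have h2 := hstep E hE0 h1
  have h3 : E ≤ c + ρ * E := by
    apply max_le
    · have hne : (F '' Set.Icc p q).Nonempty := ⟨F p, p, ⟨le_rfl, hpq⟩, rfl⟩
      apply csSup_le hne
      rintro _ ⟨t, ht, rfl⟩; exact h2 t ht
    · positivity
  intro t ht
  refine (h1 t ht).trans ?_
  rw [le_div_iff₀ (by linarith)]
  linarith

lemma lip_weight (x : ℝ → ℝ) (γ s u t d L : ℝ) (hγ : 0 ≤ γ) (hut : u ≤ t) (hd : t - u ≤ d)
    (hL0 : 0 ≤ L)
    (hdiff : ∀ v ∈ Set.Icc u t, DifferentiableAt ℝ x v)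
    (hL : ∀ v ∈ Set.Icc u t, exp (γ * (v - s)) * |deriv x v| ≤ L) :
    exp (γ * (t - s)) * |x t - x u| ≤ d * exp (γ * d) * L := by
  have h1 : ‖x t - x u‖ ≤ (L * exp (-(γ * (u - s)))) * ‖t - u‖ := by
    apply Convex.norm_image_sub_le_of_norm_deriv_le hdiff _ (convex_Icc u t)
      ⟨le_rfl, hut⟩ ⟨hut, le_rfl⟩
    intro v hv
    have h2 := hL v hv
    rw [Real.norm_eq_abs, exp_neg, ← div_eq_mul_inv, le_div_iff₀ (exp_pos _), mul_comm]
    refine le_trans ?_ h2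
    apply mul_le_mul_of_nonneg_right _ (abs_nonneg _)
    apply exp_le_exp.2
    nlinarith [hv.1]
  rw [Real.norm_eq_abs, Real.norm_eq_abs, abs_of_nonneg (by linarith : 0 ≤ t - u)] at h1
  have h3 : exp (γ * (t - s)) * exp (-(γ * (u - s))) ≤ exp (γ * d) := by
    rw [← exp_add]
    apply exp_le_exp.2
    nlinarith
  calc exp (γ * (t - s)) * |x t - x u|
      ≤ exp (γ * (t - s)) * ((L * exp (-(γ * (u - s)))) * (t - u)) :=
        mul_le_mul_of_nonneg_left h1 (exp_pos _).le
    _ = (exp (γ * (t - s)) * exp (-(γ * (u - s)))) * (L * (t - u)) := by ring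
    _ ≤ exp (γ * d) * (L * d) := by
        apply mul_le_mul h3 _ _ (exp_pos _).le
        · exact mul_le_mul_of_nonneg_left hd hL0
        · exact mul_nonneg hL0 (by linarith)
    _ = _ := by ring

lemma max_deriv (z : ℝ → ℝ) (γ s t : ℝ) (hst : s < t) (hd : DifferentiableAt ℝ z t)
    (hm : ∀ u ∈ Set.Icc s t, exp (γ * (u - s)) * z u ≤ exp (γ * (t - s)) * z t) :
    0 ≤ γ * (exp (γ * (t - s)) * z t) + exp (γ * (t - s)) * deriv z t := by
  have hE : HasDerivAt (fun u => exp (γ * (u - s))) (exp (γ * (t - s)) * γ) t := by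
    have : HasDerivAt (fun u => γ * (u - s)) γ t := by
      simpa using ((hasDerivAt_id t).sub_const s).const_mul γ
    exact this.exp
  have hy := hE.mul hd.hasDerivAt
  set y : ℝ → ℝ := fun u => exp (γ * (u - s)) * z u with hydef
  have hmax : IsLocalMaxOn y (Set.Icc s t) t := by
    apply IsMaxOn.localize
    intro u hu
    exact hm u hu
  have h1 := hmax.hasFDerivWithinAt_nonpos (y := s - t) hy.hasFDerivAt.hasFDerivWithinAt
    (by
      apply mem_posTangentConeAt_of_segment_subset
      rw [segment_symm]
      simp [segment_eq_Icc hst.le])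
  simp at h1
  nlinarith

lemma max_point (x : ℝ → ℝ) (γ s t1 : ℝ) (hst : s ≤ t1)
    (hd : ∀ t ∈ Set.Icc s t1, DifferentiableAt ℝ x t) :
    ∃ N, ∃ t' ∈ Set.Icc s t1, 0 ≤ N ∧ (∀ t ∈ Set.Icc s t1, exp (γ * (t - s)) * |x t| ≤ N) ∧
      N = exp (γ * (t' - s)) * |x t'| ∧
      (s < t' → (N = exp (γ * (t' - s)) * x t' ∧ 0 ≤ γ * N + exp (γ * (t' - s)) * deriv x t') ∨
        (N = exp (γ * (t' - s)) * (-x) t' ∧ 0 ≤ γ * N + exp (γ * (t' - s)) * deriv (-x) t')) := by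
  have hc : ContinuousOn (fun t => exp (γ * (t - s)) * |x t|) (Set.Icc s t1) := by
    apply ContinuousOn.mul (by fun_prop)
    apply ContinuousOn.abs
    exact fun t ht => (hd t ht).continuousAt.continuousWithinAt
  obtain ⟨t', ht', hmax⟩ := isCompact_Icc.exists_isMaxOn ⟨s, le_rfl, hst⟩ hc
  have hmax' : ∀ t ∈ Set.Icc s t1, exp (γ * (t - s)) * |x t| ≤ exp (γ * (t' - s)) * |x t'| :=
    fun t ht => hmax ht
  refine ⟨_, t', ht', by positivity, hmax', rfl, ?_⟩
  intro hs
  rcases le_total 0 (x t') with h0 | h0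
  · left
    rw [abs_of_nonneg h0] at hmax' ⊢
    refine ⟨rfl, max_deriv x γ s t' hs (hd t' ht') ?_⟩
    intro u hu
    refine le_trans ?_ (hmax' u ⟨hu.1, hu.2.trans ht'.2⟩)
    exact mul_le_mul_of_nonneg_left (le_abs_self _) (exp_pos _).le
  · right
    rw [abs_of_nonpos h0] at hmax' ⊢
    refine ⟨rfl, max_deriv (-x) γ s t' hs (hd t' ht').neg ?_⟩
    intro u hu
    refine le_trans ?_ (hmax' u ⟨hu.1, hu.2.trans ht'.2⟩)
    exact mul_le_mul_of_nonneg_left (neg_le_abs _) (exp_pos _).le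

lemma ae_abs_weight (x : ℝ → ℝ) (γ s p q C R : ℝ) (hpq : p < q)
    (hd : ∀ t ∈ Set.Icc p q, DifferentiableAt ℝ x t)
    (hC : ∀ t ∈ Set.Icc p q, |deriv x t| ≤ C)
    (hae : ∀ᵐ t : ℝ ∂volume, t ∈ Set.Icc p q → exp (γ * (t - s)) * |deriv x t| ≤ R) :
    ∀ t ∈ Set.Icc p q, exp (γ * (t - s)) * |deriv x t| ≤ R := by
  have key : ∀ t, exp (γ * (t - s)) * |deriv x t| ≤ R ↔ |deriv x t| ≤ R / exp (γ * (t - s)) := by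
    intro t
    rw [le_div_iff₀ (exp_pos _), mul_comm]
  simp only [key] at hae ⊢
  have hU : ContinuousOn (fun t => R / exp (γ * (t - s))) (Set.Icc p q) := by
    apply ContinuousOn.div (by fun_prop) (by fun_prop)
    intro t _; exact (exp_pos _).ne'
  have h1 := ae_to_all x _ p q C hpq hd hC hU (by
    filter_upwards [hae] with t ht hm
    exact (le_abs_self _).trans (ht hm))
  have h2 := ae_to_all (-x) _ p q C hpq (fun t ht => (hd t ht).neg)
    (by intro t ht; rw [deriv.neg, abs_neg]; exact hC t ht) hU (by
    filter_upwards [hae] with t ht hm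
    rw [deriv.neg]
    exact (neg_le_abs _).trans (ht hm))
  intro t ht
  have h3 := h2 t ht
  rw [deriv.neg] at h3
  exact abs_le.2 ⟨by linarith, h1 t ht⟩

lemma crude (a b g h ψ x : ℝ → ℝ) (s r A0 B0 K : ℝ) (hr : 0 < r) (hA0 : 0 ≤ A0) (hA1 : A0 < 1)
    (hB0 : 0 < B0)
    (hd : ∀ t, s ≤ t → DifferentiableAt ℝ x t)
    (hb : ∀ t1, s ≤ t1 → ∃ C : ℝ, ∀ t ∈ Set.Icc s t1, |deriv x t| ≤ C)
    (hx : ∀ t ≤ s, |x t| ≤ K) (hψ : ∀ t ≤ s, |ψ t| ≤ K)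
    (hall : ∀ᵐ t : ℝ ∂volume, s ≤ t → g t ≤ t ∧ h t ≤ t ∧
      (0 ≤ a t ∧ a t ≤ A0 ∧ 0 ≤ b t ∧ b t ≤ B0) ∧
      deriv x t = a t * Dfun x ψ s (g t) - b t * x (h t)) :
    ∀ t ∈ Set.Icc s (s + r),
      |x t| ≤ (exp (2 * B0 / (1 - A0) * r) * ((3 + A0 / B0) + (4 * B0 + 2 * A0) / (1 - A0))) * K ∧
      |deriv x t| ≤
        (exp (2 * B0 / (1 - A0) * r) * ((3 + A0 / B0) + (4 * B0 + 2 * A0) / (1 - A0))) * K := by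
  have hK : 0 ≤ K := (abs_nonneg _).trans (hx s le_rfl)
  have h1A : 0 < 1 - A0 := by linarith
  set l := 2 * B0 / (1 - A0) with hl
  have hl0 : 0 < l := by positivity
  obtain ⟨C, hC⟩ := hb (s + r) (by linarith)
  have hdI : ∀ t ∈ Set.Icc s (s + r), DifferentiableAt ℝ x t := fun t ht => hd t ht.1
  obtain ⟨N, t', ht', hN0, hN, hNe, hNd⟩ := max_point x (-l) s (s + r) (by linarith) hdI
  have hL : ∀ t ∈ Set.Icc s (s + r), exp (-l * (t - s)) * |deriv x t| ≤
      (B0 * N + (A0 + B0) * K) / (1 - A0) := by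
    apply sup_contr (fun t => exp (-l * (t - s)) * |deriv x t|) s (s + r) _ A0 C (by linarith)
      hA0 hA1 (by positivity)
    · intro t ht
      have : exp (-l * (t - s)) ≤ 1 := by
        apply exp_le_one_iff.2; nlinarith [ht.1]
      calc _ ≤ 1 * |deriv x t| := mul_le_mul_of_nonneg_right this (abs_nonneg _)
        _ ≤ C := by rw [one_mul]; exact hC t ht
    · intro E hE0 hE
      apply ae_abs_weight x (-l) s s (s + r) C _ (by linarith) hdI hC
      filter_upwards [hall] with t ht hm
      obtain ⟨hg, hh, ⟨ha1, ha2, hb1, hb2⟩, heq⟩ := ht hm.1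
      have hw1 : exp (-l * (t - s)) ≤ 1 := by
        apply exp_le_one_iff.2; nlinarith [hm.1]
      have hmon : ∀ u ≤ t, exp (-l * (t - s)) ≤ exp (-l * (u - s)) := by
        intro u hu; apply exp_le_exp.2; nlinarith
      have hw0 := exp_pos (-l * (t - s))
      have e1 : exp (-l * (t - s)) * |Dfun x ψ s (g t)| ≤ K + E := by
        unfold Dfun
        split_ifs with hs
        · have := hE (g t) ⟨hs, hg.trans hm.2⟩
          have h3 := mul_le_mul_of_nonneg_right (hmon (g t) hg) (abs_nonneg (deriv x (g t)))
          linarith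
        · have := hψ (g t) (not_le.1 hs).le
          have h3 := mul_le_mul hw1 this (abs_nonneg _) zero_le_one
          linarith
      have e2 : exp (-l * (t - s)) * |x (h t)| ≤ K + N := by
        by_cases hs : s ≤ h t
        · have := hN (h t) ⟨hs, hh.trans hm.2⟩
          have h3 := mul_le_mul_of_nonneg_right (hmon (h t) hh) (abs_nonneg (x (h t)))
          linarith
        · have := hx (h t) (not_le.1 hs).le
          have h3 := mul_le_mul hw1 this (abs_nonneg _) zero_le_one
          linarith
      have e3 : |deriv x t| ≤ a t * |Dfun x ψ s (g t)| + b t * |x (h t)| := by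
        rw [heq]
        refine (abs_sub _ _).trans ?_
        rw [abs_mul, abs_mul, abs_of_nonneg ha1, abs_of_nonneg hb1]
      have e4 : a t * (exp (-l * (t - s)) * |Dfun x ψ s (g t)|) ≤ A0 * (K + E) :=
        mul_le_mul ha2 e1 (by positivity) hA0
      have e5 : b t * (exp (-l * (t - s)) * |x (h t)|) ≤ B0 * (K + N) :=
        mul_le_mul hb2 e2 (by positivity) hB0.le
      have e6 := mul_le_mul_of_nonneg_left e3 hw0.le
      nlinarith
  have hNK : N ≤ (3 + A0 / B0) * K := by
    have hAB : 0 ≤ A0 / B0 := by positivity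
    rcases eq_or_lt_of_le ht'.1 with h0 | h0
    · rw [hNe, ← h0]
      have := hx s le_rfl
      simp
      nlinarith [mul_nonneg hAB hK]
    · have h2 : l * N ≤ (B0 * N + (A0 + B0) * K) / (1 - A0) := by
        have h3 := hL t' ht'
        have hw0 := exp_pos (-l * (t' - s))
        rcases hNd h0 with ⟨_, h4⟩ | ⟨_, h4⟩
        · have := mul_le_mul_of_nonneg_left (le_abs_self (deriv x t')) hw0.le
          linarith
        · rw [deriv.neg] at h4
          have := mul_le_mul_of_nonneg_left (neg_le_abs (deriv x t')) hw0.le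
          linarith
      rw [hl, le_div_iff₀ h1A] at h2
      have h5 : 2 * B0 / (1 - A0) * N * (1 - A0) = 2 * B0 * N := by field_simp
      rw [h5] at h2
      have h6 : (3 + A0 / B0) * K = (3 * B0 + A0) * K / B0 := by field_simp
      rw [h6, le_div_iff₀ hB0]
      nlinarith [mul_nonneg hB0.le hK]
  have hLK : (B0 * N + (A0 + B0) * K) / (1 - A0) ≤ (4 * B0 + 2 * A0) / (1 - A0) * K := by
    rw [div_mul_eq_mul_div]
    apply div_le_div_of_nonneg_right _ h1A.le
    have h6 : B0 * ((3 + A0 / B0) * K) = (3 * B0 + A0) * K := by field_simp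
    have := mul_le_mul_of_nonneg_left hNK hB0.le
    nlinarith
  have hc1 : 0 ≤ (3 + A0 / B0) * K := by positivity
  have hc2 : 0 ≤ (4 * B0 + 2 * A0) / (1 - A0) * K := by positivity
  intro t ht
  have gen : ∀ y R : ℝ, 0 ≤ R → exp (-l * (t - s)) * y ≤ R → y ≤ exp (l * r) * R := by
    intro y R hR hy
    have h7 : y = exp (l * (t - s)) * (exp (-l * (t - s)) * y) := by
      rw [← mul_assoc, ← exp_add]; ring_nf; simp
    rw [h7]
    have h8 : exp (l * (t - s)) ≤ exp (l * r) := by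
      apply exp_le_exp.2; nlinarith [ht.2]
    exact (mul_le_mul_of_nonneg_left hy (exp_pos _).le).trans (mul_le_mul_of_nonneg_right h8 hR)
  constructor
  · rw [mul_assoc]
    apply gen _ _ (by nlinarith)
    have := hN t ht
    linarith
  · rw [mul_assoc]
    apply gen _ _ (by nlinarith)
    have := hL t ht
    linarith

lemma step_alg (a b a0 A0 b0 B0 lo hi L τ' σ ρ1 β' E e1 wu w zt zu zh dzu P : ℝ)
    (ha0 : 0 ≤ a0) (ha : a0 ≤ a) (haA : a ≤ A0) (hb : b0 ≤ b) (hbB : b ≤ B0) (hb0 : 0 < b0)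
    (hlo : a0 * lo + b0 = lo) (hhi : A0 * hi + B0 = hi) (hlo0 : 0 < lo)
    (hβ1 : lo ≤ β') (hβ2 : β' ≤ hi) (hL : 0 ≤ L) (hτ : 0 ≤ τ') (hσ : 0 ≤ σ)
    (hE : 0 ≤ E) (he1 : 1 ≤ e1) (he2 : e1 ≤ ρ1) (hw : w = e1 * wu)
    (h1 : wu * dzu ≤ β' * (L * τ' - wu * zu) + E)
    (h2 : w * |zt - zu| ≤ σ * ρ1 * L)
    (h3 : w * |zt - zh| ≤ τ' * L) (hw0 : 0 < w)
    (hP : P = w * (a * dzu - b * zh)) :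
    P ≤ max (lo * (L * τ' - w * zt)) (hi * (L * τ' - w * zt)) +
      (L * (A0 * hi * (τ' * (ρ1 - 1) + σ * ρ1)) + A0 * ρ1 * E) := by
  have ha' : 0 ≤ a := ha0.trans ha
  have hA' : 0 ≤ A0 := ha'.trans haA
  have hβ0 : 0 < β' := hlo0.trans_le hβ1
  have hρ : 1 ≤ ρ1 := he1.trans he2
  have k2 : w * (zt - zu) ≤ σ * ρ1 * L :=
    (mul_le_mul_of_nonneg_left (le_abs_self _) hw0.le).trans h2
  have k3 : w * (zt - zh) ≤ τ' * L :=
    (mul_le_mul_of_nonneg_left (le_abs_self _) hw0.le).trans h3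
  have k1 : w * dzu ≤ β' * (e1 * (L * τ') - w * zu) + e1 * E := by
    have := mul_le_mul_of_nonneg_left h1 (by linarith : 0 ≤ e1)
    rw [hw]; nlinarith
  have hLt : 0 ≤ L * τ' := by positivity
  have k4 : e1 * (L * τ') - w * zu ≤ (L * τ' - w * zt) + L * (τ' * (ρ1 - 1) + σ * ρ1) := by
    have := mul_le_mul_of_nonneg_right he2 hLt
    nlinarith
  have hX : 0 ≤ L * (τ' * (ρ1 - 1) + σ * ρ1) := by
    have : 0 ≤ ρ1 - 1 := by linarith
    positivity
  have k5 : w * dzu ≤ β' * (L * τ' - w * zt) + hi * (L * (τ' * (ρ1 - 1) + σ * ρ1)) + ρ1 * E := by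
    have e1' := mul_le_mul_of_nonneg_left k4 hβ0.le
    have e2' := mul_le_mul_of_nonneg_right hβ2 hX
    have e3' := mul_le_mul_of_nonneg_right he2 hE
    linarith
  have k6 : -(b * (w * zh)) ≤ b * (L * τ' - w * zt) := by
    have : -(w * zh) ≤ L * τ' - w * zt := by linarith
    have := mul_le_mul_of_nonneg_left this (hb0.le.trans hb)
    linarith
  have hhi0 : 0 < hi := hβ0.trans_le hβ2
  have hY : 0 ≤ hi * (L * (τ' * (ρ1 - 1) + σ * ρ1)) + ρ1 * E := by positivity
  have k7 : P ≤ (a * β' + b) * (L * τ' - w * zt) +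
      A0 * (hi * (L * (τ' * (ρ1 - 1) + σ * ρ1)) + ρ1 * E) := by
    have e1' := mul_le_mul_of_nonneg_left k5 ha'
    have e2' := mul_le_mul_of_nonneg_right haA hY
    rw [hP]; linarith
  have hB1 : lo ≤ a * β' + b := by
    have := mul_le_mul ha hβ1 hlo0.le ha'
    linarith
  have hB2 : a * β' + b ≤ hi := by
    have := mul_le_mul haA hβ2 hβ0.le hA'
    linarith
  have k8 : (a * β' + b) * (L * τ' - w * zt) ≤
      max (lo * (L * τ' - w * zt)) (hi * (L * τ' - w * zt)) := by
    rcases le_total 0 (L * τ' - w * zt) with h0 | h0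
    · exact (mul_le_mul_of_nonneg_right hB2 h0).trans (le_max_right _ _)
    · exact (mul_le_mul_of_nonpos_right hB1 h0).trans (le_max_left _ _)
  linarith

lemma upper (a b g h z : ℝ → ℝ) (s r t1 σ τ a0 A0 b0 B0 lo hi γ L N C Q : ℝ)
    (hr : 0 < r) (ht1 : s + r < t1) (hσ : 0 < σ) (hτ : 0 < τ) (hγ : 0 < γ)
    (ha0 : 0 ≤ a0) (hA0 : 0 ≤ A0) (hb0 : 0 < b0)
    (hlo : a0 * lo + b0 = lo) (hhi : A0 * hi + B0 = hi) (hlo0 : 0 < lo) (hlohi : lo ≤ hi)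
    (hL0 : 0 ≤ L) (hQ : 0 ≤ Q)
    (hρ : A0 * exp (γ * σ) < 1)
    (hd : ∀ t ∈ Set.Icc s t1, DifferentiableAt ℝ z t)
    (hC : ∀ t ∈ Set.Icc s t1, |deriv z t| ≤ C)
    (hL : ∀ t ∈ Set.Icc s t1, exp (γ * (t - s)) * |deriv z t| ≤ L)
    (hN : ∀ t ∈ Set.Icc s t1, exp (γ * (t - s)) * |z t| ≤ N)
    (hin : ∀ t ∈ Set.Icc s (s + r), exp (γ * (t - s)) * deriv z t
      + lo * (exp (γ * (t - s)) * z t) ≤ Q)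
    (heq : ∀ᵐ t : ℝ ∂volume, t ∈ Set.Icc (s + r) t1 → (s ≤ g t ∧ g t ≤ t ∧ t - g t ≤ σ) ∧
      (s ≤ h t ∧ h t ≤ t ∧ t - h t ≤ τ) ∧ (a0 ≤ a t ∧ a t ≤ A0 ∧ b0 ≤ b t ∧ b t ≤ B0) ∧
      deriv z t = a t * deriv z (g t) - b t * z (h t)) :
    ∀ t ∈ Set.Icc s t1, exp (γ * (t - s)) * deriv z t
      - max (lo * (L * (τ * exp (γ * τ)) - exp (γ * (t - s)) * z t))
         (hi * (L * (τ * exp (γ * τ)) - exp (γ * (t - s)) * z t)) ≤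
      (Q + L * (A0 * hi * ((τ * exp (γ * τ)) * (exp (γ * σ) - 1) + σ * exp (γ * σ))))
        / (1 - A0 * exp (γ * σ)) := by
  have hρ1 : 1 ≤ exp (γ * σ) := one_le_exp (by positivity)
  have hhi0 : 0 < hi := hlo0.trans_le hlohi
  set τ' := τ * exp (γ * τ) with hτ'
  have hτ'0 : 0 < τ' := by positivity
  have hk0 : 0 ≤ L * (A0 * hi * (τ' * (exp (γ * σ) - 1) + σ * exp (γ * σ))) := by
    have : 0 ≤ exp (γ * σ) - 1 := by linarith
    positivity
  have hlt : 0 ≤ L * τ' := by positivity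
  apply sup_contr (fun t => exp (γ * (t - s)) * deriv z t
      - max (lo * (L * τ' - exp (γ * (t - s)) * z t))
         (hi * (L * τ' - exp (γ * (t - s)) * z t))) s t1 _ _ (L + lo * N) (by linarith)
      (by positivity) hρ (by positivity)
  · intro t ht
    have e1 := hL t ht
    have e2 := hN t ht
    have e3 := mul_le_mul_of_nonneg_left (le_abs_self (deriv z t)) (exp_pos (γ * (t - s))).le
    have e4 := mul_le_mul_of_nonneg_left (le_abs_self (z t)) (exp_pos (γ * (t - s))).le
    have e5 := le_max_left (lo * (L * τ' - exp (γ * (t - s)) * z t))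
         (hi * (L * τ' - exp (γ * (t - s)) * z t))
    have e6 := mul_le_mul_of_nonneg_left (e4.trans e2) hlo0.le
    have e7 := mul_nonneg hlo0.le hlt
    nlinarith
  · intro E hE0 hE t ht
    rcases le_total t (s + r) with hts | hts
    · have e1 := hin t ⟨ht.1, hts⟩
      have e5 := le_max_left (lo * (L * τ' - exp (γ * (t - s)) * z t))
         (hi * (L * τ' - exp (γ * (t - s)) * z t))
      have e7 := mul_nonneg hlo0.le hlt
      have e8 : 0 ≤ A0 * exp (γ * σ) * E := by positivity
      nlinarith
    · have hsub : ∀ t ∈ Set.Icc (s + r) t1, t ∈ Set.Icc s t1 := fun t ht => ⟨by linarith [ht.1], ht.2⟩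
      have hzc : ContinuousOn z (Set.Icc (s + r) t1) := fun t ht =>
        (hd t (hsub t ht)).continuousAt.continuousWithinAt
      have key := ae_to_all z (fun t => (max (lo * (L * τ' - exp (γ * (t - s)) * z t))
         (hi * (L * τ' - exp (γ * (t - s)) * z t)) +
         (L * (A0 * hi * (τ' * (exp (γ * σ) - 1) + σ * exp (γ * σ))) + A0 * exp (γ * σ) * E))
          * exp (-(γ * (t - s)))) (s + r) t1 C ht1
          (fun t ht => hd t (hsub t ht)) (fun t ht => hC t (hsub t ht)) (by
            apply ContinuousOn.mul _ (by fun_prop)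
            apply ContinuousOn.add _ (by fun_prop)
            apply ContinuousOn.sup <;> fun_prop) (by
            filter_upwards [heq] with t ht hm
            obtain ⟨⟨hg1, hg2, hg3⟩, ⟨hh1, hh2, hh3⟩, ⟨c1, c2, c3, c4⟩, he⟩ := ht hm
            rw [exp_neg, ← div_eq_mul_inv, le_div_iff₀ (exp_pos _), mul_comm]
            have hEg := hE (g t) ⟨hg1, hg2.trans hm.2⟩
            obtain ⟨β', hβ1, hβ2, hβ⟩ : ∃ β', lo ≤ β' ∧ β' ≤ hi ∧
                exp (γ * (g t - s)) * deriv z (g t) ≤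
                  β' * (L * τ' - exp (γ * (g t - s)) * z (g t)) + E := by
              rcases max_choice (lo * (L * τ' - exp (γ * (g t - s)) * z (g t)))
                (hi * (L * τ' - exp (γ * (g t - s)) * z (g t))) with hc | hc
              · exact ⟨lo, le_rfl, hlohi, by linarith⟩
              · exact ⟨hi, hlohi, le_rfl, by linarith⟩
            apply step_alg (a t) (b t) a0 A0 b0 B0 lo hi L τ' σ (exp (γ * σ)) β' E
              (exp (γ * (t - g t))) (exp (γ * (g t - s))) (exp (γ * (t - s))) (z t) (z (g t))
              (z (h t)) (deriv z (g t)) _ ha0 c1 c2 c3 c4 hb0 hlo hhi hlo0 hβ1 hβ2 hL0 hτ'0.le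
              hσ.le hE0 (one_le_exp (mul_nonneg hγ.le (by linarith)))
              (exp_le_exp.2 (mul_le_mul_of_nonneg_left hg3 hγ.le)) (by
                rw [← exp_add]; ring_nf) hβ
              (lip_weight z γ s (g t) t σ L hγ.le hg2 hg3 hL0
                (fun v hv => hd v ⟨hg1.trans hv.1, hv.2.trans hm.2⟩)
                (fun v hv => hL v ⟨hg1.trans hv.1, hv.2.trans hm.2⟩))
              (lip_weight z γ s (h t) t τ L hγ.le hh2 hh3 hL0
                (fun v hv => hd v ⟨hh1.trans hv.1, hv.2.trans hm.2⟩)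
                (fun v hv => hL v ⟨hh1.trans hv.1, hv.2.trans hm.2⟩))
              (exp_pos _) (by rw [he])) t ⟨hts, ht.2⟩
      rw [exp_neg, ← div_eq_mul_inv, le_div_iff₀ (exp_pos _), mul_comm] at key
      linarith

lemma final_alg (N L E k γ lo hi β τ' k1 D c2 θ : ℝ) (hlohi : lo ≤ β) (hβ : β ≤ hi) (hlo : 0 < lo)
    (hN : 0 ≤ N) (hk : 0 ≤ k) (hτ : 0 ≤ τ') (hD : 0 ≤ D)
    (hθ : θ = lo * (1 - c2 * D * τ') - γ - c2 * D * k1 * D) (hθ0 : 0 < θ)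
    (hc : 0 ≤ 1 - c2 * D * τ')
    (hL : L = (k + c2 * N) * D) (hE : E = ((1 + lo) * k + L * k1) * D)
    (h : 0 ≤ γ * N + (β * (L * τ' - N) + E)) :
    N ≤ k * (1 + (hi * τ' * D + ((1 + lo) + D * k1) * D) / θ) := by
  have h1 : β * (N * (1 - c2 * D * τ')) ≤ γ * N + E + β * (τ' * (k * D)) := by
    rw [hL] at h; nlinarith
  have h2 : lo * (N * (1 - c2 * D * τ')) ≤ β * (N * (1 - c2 * D * τ')) :=
    mul_le_mul_of_nonneg_right hlohi (mul_nonneg hN hc)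
  have h3 : β * (τ' * (k * D)) ≤ hi * (τ' * (k * D)) :=
    mul_le_mul_of_nonneg_right hβ (by positivity)
  have h4 : θ * N ≤ k * (hi * τ' * D + ((1 + lo) + D * k1) * D) := by
    rw [hE, hL] at h1
    rw [hθ]
    linarith
  have h5 : N ≤ k * (hi * τ' * D + ((1 + lo) + D * k1) * D) / θ := by
    rw [le_div_iff₀ hθ0]; linarith
  calc N ≤ k * (hi * τ' * D + ((1 + lo) + D * k1) * D) / θ := h5
    _ ≤ k + k * (hi * τ' * D + ((1 + lo) + D * k1) * D) / θ := by linarith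
    _ = _ := by ring

lemma main_bound (a b g h x : ℝ → ℝ) (s r t1 σ τ a0 A0 b0 B0 lo hi γ C k τ' k1 D c2 θ : ℝ)
    (hr : 0 < r) (ht1 : s + r < t1) (hσ : 0 < σ) (hτ : 0 < τ) (hγ : 0 < γ)
    (ha0 : 0 ≤ a0) (hA0 : 0 ≤ A0) (hb0 : 0 < b0) (hB0 : 0 < B0)
    (hlo : a0 * lo + b0 = lo) (hhi : A0 * hi + B0 = hi) (hlo0 : 0 < lo) (hlohi : lo ≤ hi)
    (hk : 0 ≤ k)
    (hρ : A0 * exp (γ * σ) < 1)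
    (hτ' : τ' = τ * exp (γ * τ))
    (hk1 : k1 = A0 * hi * (τ' * (exp (γ * σ) - 1) + σ * exp (γ * σ)))
    (hD : D = (1 - A0 * exp (γ * σ))⁻¹)
    (hc2 : c2 = B0 * exp (γ * τ))
    (hθ : θ = lo * (1 - c2 * D * τ') - γ - c2 * D * k1 * D) (hθ0 : 0 < θ)
    (hc : 0 ≤ 1 - c2 * D * τ')
    (hd : ∀ t ∈ Set.Icc s t1, DifferentiableAt ℝ x t)
    (hC : ∀ t ∈ Set.Icc s t1, |deriv x t| ≤ C)
    (hin1 : ∀ t ∈ Set.Icc s (s + r), exp (γ * (t - s)) * |x t| ≤ k)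
    (hin2 : ∀ t ∈ Set.Icc s (s + r), exp (γ * (t - s)) * |deriv x t| ≤ k)
    (heq : ∀ᵐ t : ℝ ∂volume, t ∈ Set.Icc (s + r) t1 → (s ≤ g t ∧ g t ≤ t ∧ t - g t ≤ σ) ∧
      (s ≤ h t ∧ h t ≤ t ∧ t - h t ≤ τ) ∧ (a0 ≤ a t ∧ a t ≤ A0 ∧ b0 ≤ b t ∧ b t ≤ B0) ∧
      deriv x t = a t * deriv x (g t) - b t * x (h t)) :
    ∀ t ∈ Set.Icc s t1, exp (γ * (t - s)) * |x t| ≤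
      k * (1 + (hi * τ' * D + ((1 + lo) + D * k1) * D) / θ) := by
  have hτ'0 : 0 < τ' := by rw [hτ']; positivity
  have hhi0 : 0 < hi := hlo0.trans_le hlohi
  have h1ρ : 0 < 1 - A0 * exp (γ * σ) := by linarith
  have hD0 : 0 < D := by rw [hD]; positivity
  have hk10 : 0 ≤ k1 := by
    have : 0 ≤ exp (γ * σ) - 1 := by linarith [one_le_exp (by positivity : 0 ≤ γ * σ)]
    rw [hk1]; positivity
  have hc20 : 0 < c2 := by rw [hc2]; positivity
  obtain ⟨N, t', ht', hN0, hN, hNe, hNd⟩ := max_point x γ s t1 (by linarith) hd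
  have hsub : ∀ t ∈ Set.Icc (s + r) t1, t ∈ Set.Icc s t1 := fun t ht => ⟨by linarith [ht.1], ht.2⟩
  obtain ⟨L, hLdef⟩ : ∃ L, L = (k + c2 * N) * D := ⟨_, rfl⟩
  have hL0 : 0 ≤ L := by rw [hLdef]; positivity
  have hL : ∀ t ∈ Set.Icc s t1, exp (γ * (t - s)) * |deriv x t| ≤ L := by
    rw [hLdef, hD, ← div_eq_mul_inv]
    apply sup_contr (fun t => exp (γ * (t - s)) * |deriv x t|) s t1 _ _ (exp (γ * (t1 - s)) * C)
      (by linarith) (by positivity) hρ (by positivity)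
    · intro t ht
      apply mul_le_mul _ (hC t ht) (abs_nonneg _) (exp_pos _).le
      apply exp_le_exp.2
      nlinarith [ht.2]
    · intro E hE0 hE t ht
      rcases le_total t (s + r) with hts | hts
      · have := hin2 t ⟨ht.1, hts⟩
        have e1 : 0 ≤ c2 * N := by positivity
        have e2 : 0 ≤ A0 * exp (γ * σ) * E := by positivity
        linarith
      · refine ae_abs_weight x γ s (s + r) t1 C _ ht1 (fun t ht => hd t (hsub t ht))
          (fun t ht => hC t (hsub t ht)) ?_ t ⟨hts, ht.2⟩
        filter_upwards [heq] with t ht hm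
        obtain ⟨⟨hg1, hg2, hg3⟩, ⟨hh1, hh2, hh3⟩, ⟨c1, c2', c3, c4⟩, he⟩ := ht hm
        have wgen : ∀ u d, t - u ≤ d → exp (γ * (t - s)) ≤ exp (γ * d) * exp (γ * (u - s)) := by
          intro u d hu
          rw [← exp_add]; apply exp_le_exp.2; nlinarith
        have e1 : exp (γ * (t - s)) * |deriv x (g t)| ≤ exp (γ * σ) * E := by
          have h1 := mul_le_mul_of_nonneg_right (wgen (g t) σ hg3) (abs_nonneg (deriv x (g t)))
          have h2 := mul_le_mul_of_nonneg_left (hE (g t) ⟨hg1, hg2.trans hm.2⟩) (exp_pos (γ * σ)).le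
          linarith
        have e2 : exp (γ * (t - s)) * |x (h t)| ≤ exp (γ * τ) * N := by
          have h1 := mul_le_mul_of_nonneg_right (wgen (h t) τ hh3) (abs_nonneg (x (h t)))
          have h2 := mul_le_mul_of_nonneg_left (hN (h t) ⟨hh1, hh2.trans hm.2⟩) (exp_pos (γ * τ)).le
          linarith
        have e3 : |deriv x t| ≤ a t * |deriv x (g t)| + b t * |x (h t)| := by
          rw [he]
          refine (abs_sub _ _).trans ?_
          rw [abs_mul, abs_mul, abs_of_nonneg (ha0.trans c1), abs_of_nonneg (hb0.le.trans c3)]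
        have e4 : a t * (exp (γ * (t - s)) * |deriv x (g t)|) ≤ A0 * (exp (γ * σ) * E) :=
          mul_le_mul c2' e1 (by positivity) hA0
        have e5 : b t * (exp (γ * (t - s)) * |x (h t)|) ≤ B0 * (exp (γ * τ) * N) :=
          mul_le_mul c4 e2 (by positivity) hB0.le
        have e6 := mul_le_mul_of_nonneg_left e3 (exp_pos (γ * (t - s))).le
        rw [hc2]
        linarith
  have hfin : N ≤ k * (1 + (hi * τ' * D + ((1 + lo) + D * k1) * D) / θ) := by
    rcases le_total t' (s + r) with hts | hts
    · have h1 := hin1 t' ⟨ht'.1, hts⟩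
      rw [← hNe] at h1
      have h2 : 0 ≤ k * ((hi * τ' * D + ((1 + lo) + D * k1) * D) / θ) := by positivity
      linarith
    · have gen : ∀ z : ℝ → ℝ, (∀ t ∈ Set.Icc s t1, DifferentiableAt ℝ z t) →
          (∀ t, |deriv z t| = |deriv x t|) → (∀ t, |z t| = |x t|) →
          (∀ᵐ t : ℝ ∂volume, t ∈ Set.Icc (s + r) t1 → (s ≤ g t ∧ g t ≤ t ∧ t - g t ≤ σ) ∧
            (s ≤ h t ∧ h t ≤ t ∧ t - h t ≤ τ) ∧ (a0 ≤ a t ∧ a t ≤ A0 ∧ b0 ≤ b t ∧ b t ≤ B0) ∧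
            deriv z t = a t * deriv z (g t) - b t * z (h t)) →
          N = exp (γ * (t' - s)) * z t' → 0 ≤ γ * N + exp (γ * (t' - s)) * deriv z t' →
          N ≤ k * (1 + (hi * τ' * D + ((1 + lo) + D * k1) * D) / θ) := by
        intro z hzd hz1 hz2 hzeq hzN hz0
        have hu := upper a b g h z s r t1 σ τ a0 A0 b0 B0 lo hi γ L N C ((1 + lo) * k) hr ht1 hσ hτ
          hγ ha0 hA0 hb0 hlo hhi hlo0 hlohi hL0 (by positivity) hρ hzd
          (fun t ht => by rw [hz1]; exact hC t ht) (fun t ht => by rw [hz1]; exact hL t ht)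
          (fun t ht => by rw [hz2]; exact hN t ht) (by
            intro t ht
            have w0 := (exp_pos (γ * (t - s))).le
            have e1 := hin1 t ht
            have e2 := hin2 t ht
            rw [← hz2] at e1
            rw [← hz1] at e2
            have e3 := (mul_le_mul_of_nonneg_left (le_abs_self (z t)) w0).trans e1
            have e4 := (mul_le_mul_of_nonneg_left (le_abs_self (deriv z t)) w0).trans e2
            have e5 := mul_le_mul_of_nonneg_left e3 hlo0.le
            linarith) hzeq t' ht'
        rw [← hτ', ← hk1, ← hzN, div_eq_mul_inv, ← hD] at hu
        rcases max_choice (lo * (L * τ' - N)) (hi * (L * τ' - N)) with hm | hm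
        · rw [hm] at hu
          exact final_alg N L _ k γ lo hi lo τ' k1 D c2 θ le_rfl hlohi hlo0 hN0 hk hτ'0.le hD0.le hθ
            hθ0 hc hLdef rfl (by linarith)
        · rw [hm] at hu
          exact final_alg N L _ k γ lo hi hi τ' k1 D c2 θ hlohi le_rfl hlo0 hN0 hk hτ'0.le hD0.le hθ
            hθ0 hc hLdef rfl (by linarith)
      rcases hNd (by linarith) with ⟨h1, h2⟩ | ⟨h1, h2⟩
      · exact gen x hd (fun _ => rfl) (fun _ => rfl) heq h1 h2
      · refine gen (-x) (fun t ht => (hd t ht).neg) (fun t => by rw [deriv.neg, abs_neg])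
          (fun t => by simp) ?_ h1 h2
        filter_upwards [heq] with t ht hm
        obtain ⟨q1, q2, q3, q4⟩ := ht hm
        refine ⟨q1, q2, q3, ?_⟩
        simp only [deriv.neg, Pi.neg_apply]
        rw [q4]; ring
  exact fun t ht => (hN t ht).trans hfin

lemma exists_gamma (σ τ a0 A0 b0 B0 : ℝ) (hA0' : A0 < 1) (ha0' : a0 < 1)
    (hb0 : 0 < b0) (hσ : 0 < σ) (hA0 : 0 ≤ A0) (hB0 : 0 < B0)
    (hcond : τ * B0 + σ * A0 * B0 ^ 2 * (1 - a0) / ((1 - A0) ^ 2 * b0) < 1 - A0) :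
    ∃ γ > 0, A0 * exp (γ * σ) < 1 ∧
      0 < 1 - B0 * exp (γ * τ) * (1 - A0 * exp (γ * σ))⁻¹ * (τ * exp (γ * τ)) ∧
      0 < b0 / (1 - a0) * (1 - B0 * exp (γ * τ) * (1 - A0 * exp (γ * σ))⁻¹ * (τ * exp (γ * τ)))
        - γ - B0 * exp (γ * τ) * (1 - A0 * exp (γ * σ))⁻¹ *
          (A0 * (B0 / (1 - A0)) * ((τ * exp (γ * τ)) * (exp (γ * σ) - 1) + σ * exp (γ * σ))) *
          (1 - A0 * exp (γ * σ))⁻¹ := by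
  have h1 : 0 < 1 - A0 := by linarith
  have h2 : 0 < 1 - a0 := by linarith
  have hne : 1 - A0 * exp (0 * σ) ≠ 0 := by simp; linarith
  have hτB : τ * B0 < 1 - A0 := by
    have : 0 ≤ σ * A0 * B0 ^ 2 * (1 - a0) / ((1 - A0) ^ 2 * b0) := by positivity
    linarith
  have c1 : ContinuousAt (fun γ : ℝ => A0 * exp (γ * σ)) 0 := by fun_prop
  have c2 : ContinuousAt (fun γ : ℝ =>
      1 - B0 * exp (γ * τ) * (1 - A0 * exp (γ * σ))⁻¹ * (τ * exp (γ * τ))) 0 := by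
    fun_prop (disch := exact hne)
  have c3 : ContinuousAt (fun γ : ℝ =>
      b0 / (1 - a0) * (1 - B0 * exp (γ * τ) * (1 - A0 * exp (γ * σ))⁻¹ * (τ * exp (γ * τ)))
        - γ - B0 * exp (γ * τ) * (1 - A0 * exp (γ * σ))⁻¹ *
          (A0 * (B0 / (1 - A0)) * ((τ * exp (γ * τ)) * (exp (γ * σ) - 1) + σ * exp (γ * σ))) *
          (1 - A0 * exp (γ * σ))⁻¹) 0 := by
    fun_prop (disch := exact hne)
  have e1 := c1.eventually_lt_const (show A0 * exp (0 * σ) < 1 by simpa using hA0')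
  have e2 := c2.eventually_const_lt (u := 0) (by
    simp only [zero_mul, exp_zero, mul_one]
    have : B0 * (1 - A0)⁻¹ * τ = τ * B0 / (1 - A0) := by field_simp
    rw [this, sub_pos, div_lt_one h1]
    exact hτB)
  have e3 := c3.eventually_const_lt (u := 0) (by
    simp only [zero_mul, exp_zero, mul_one, sub_self, mul_zero, zero_add, sub_zero]
    have : b0 / (1 - a0) * (1 - B0 * (1 - A0)⁻¹ * τ) -
        B0 * (1 - A0)⁻¹ * (A0 * (B0 / (1 - A0)) * σ) * (1 - A0)⁻¹ =
        b0 / ((1 - a0) * (1 - A0)) *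
          (1 - A0 - (τ * B0 + σ * A0 * B0 ^ 2 * (1 - a0) / ((1 - A0) ^ 2 * b0))) := by
      field_simp
      ring
    rw [this]
    apply mul_pos (by positivity)
    linarith)
  have hev := (e1.and (e2.and e3)).filter_mono
    (nhdsWithin_le_nhds : nhdsWithin (0 : ℝ) (Set.Ioi 0) ≤ nhds 0)
  obtain ⟨γ, hγ, hγ0⟩ := (hev.and self_mem_nhdsWithin).exists
  exact ⟨γ, hγ0, hγ⟩

/-- Proposition 5.2: a delay-dependent exponential stability test for
`x'(t) - a(t) x'(g(t)) = -b(t) x(h(t))`. -/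
theorem proposition5_2
    (t0 : ℝ) (ht0 : 0 ≤ t0) (σ τ : ℝ) (hσ : 0 < σ) (hτ : 0 < τ)
    (a b g h : ℝ → ℝ)
    (ham : Measurable a) (hbm : Measurable b) (hgm : Measurable g) (hhm : Measurable h)
    (hgdel : ∀ᵐ t : ℝ ∂volume, t0 ≤ t → 0 ≤ t - g t ∧ t - g t ≤ σ)
    (hhdel : ∀ᵐ t : ℝ ∂volume, t0 ≤ t → 0 ≤ t - h t ∧ t - h t ≤ τ)
    (a0 A0 b0 B0 : ℝ) (ha0 : 0 ≤ a0) (hA0 : 0 ≤ A0) (hA0' : A0 < 1)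
    (hb0 : 0 < b0) (hB0 : 0 < B0)
    (hae : ∀ᵐ t : ℝ ∂volume, t0 ≤ t →
      a0 ≤ a t ∧ a t ≤ A0 ∧ b0 ≤ b t ∧ b t ≤ B0)
    (hcond : τ * B0 + σ * A0 * B0 ^ 2 * (1 - a0) / ((1 - A0) ^ 2 * b0) < 1 - A0) :
    UnifExpStable1 a b g h t0 := by

  obtain ⟨haA, hbB⟩ : a0 ≤ A0 ∧ b0 ≤ B0 := by
    obtain ⟨t, ht, ht'⟩ : ∃ t, t0 ≤ t ∧ (t0 ≤ t → a0 ≤ a t ∧ a t ≤ A0 ∧ b0 ≤ b t ∧ b t ≤ B0) := by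
      by_contra hcon
      push Not at hcon
      have : volume (Set.Ici t0) = 0 := by
        apply measure_mono_null _ (ae_iff.1 hae)
        intro t ht hh
        obtain ⟨q1, q2, q3, q4⟩ := hh ht
        exact not_lt.2 q4 ((hcon t ht).2 q1 q2 q3)
      simp at this
    obtain ⟨q1, q2, q3, q4⟩ := ht' ht
    exact ⟨q1.trans q2, q3.trans q4⟩
  have ha01 : a0 < 1 := haA.trans_lt hA0'
  have h1A : 0 < 1 - A0 := by linarith
  have h1a : 0 < 1 - a0 := by linarith
  obtain ⟨γ, hγ, hρ, hc, hθ0⟩ := exists_gamma σ τ a0 A0 b0 B0 hA0' ha01 hb0 hσ hA0 hB0 hcond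
  obtain ⟨lo, hlod⟩ : ∃ lo, lo = b0 / (1 - a0) := ⟨_, rfl⟩
  obtain ⟨hi, hhid⟩ : ∃ hi, hi = B0 / (1 - A0) := ⟨_, rfl⟩
  obtain ⟨τ', hτ'⟩ : ∃ τ', τ' = τ * exp (γ * τ) := ⟨_, rfl⟩
  obtain ⟨D, hD⟩ : ∃ D, D = (1 - A0 * exp (γ * σ))⁻¹ := ⟨_, rfl⟩
  obtain ⟨c2, hc2⟩ : ∃ c2, c2 = B0 * exp (γ * τ) := ⟨_, rfl⟩
  obtain ⟨k1, hk1⟩ : ∃ k1, k1 = A0 * hi * (τ' * (exp (γ * σ) - 1) + σ * exp (γ * σ)) := ⟨_, rfl⟩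
  obtain ⟨θ, hθ⟩ : ∃ θ, θ = lo * (1 - c2 * D * τ') - γ - c2 * D * k1 * D := ⟨_, rfl⟩
  rw [← hτ', ← hD, ← hc2] at hc
  rw [← hτ', ← hD, ← hc2, ← hlod, ← hhid, ← hk1, ← hθ] at hθ0
  have hlo0 : 0 < lo := by rw [hlod]; positivity
  have hlohi : lo ≤ hi := by
    rw [hlod, hhid]
    exact div_le_div₀ hB0.le hbB h1A (by linarith)
  have hhi0 : 0 < hi := hlo0.trans_le hlohi
  have hlo : a0 * lo + b0 = lo := by rw [hlod]; field_simp; ring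
  have hhi : A0 * hi + B0 = hi := by rw [hhid]; field_simp; ring
  have hτ'0 : 0 < τ' := by rw [hτ']; positivity
  have hD0 : 0 < D := by
    have : 0 < 1 - A0 * exp (γ * σ) := by linarith
    rw [hD]; positivity
  have hk10 : 0 ≤ k1 := by
    have : 0 ≤ exp (γ * σ) - 1 := by linarith [one_le_exp (by positivity : 0 ≤ γ * σ)]
    rw [hk1]; positivity
  set r := σ + τ with hr
  have hr0 : 0 < r := by positivity
  set Cc := exp (2 * B0 / (1 - A0) * r) * ((3 + A0 / B0) + (4 * B0 + 2 * A0) / (1 - A0)) with hCc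
  have hCc0 : 0 < Cc := by positivity
  set M := exp (γ * r) * Cc * (1 + (hi * τ' * D + ((1 + lo) + D * k1) * D) / θ) with hM
  refine ⟨M, by positivity, γ, hγ, ?_⟩
  intro s hs φ ψ x hφb hψb ⟨hx1, hx2, hx3, hx4⟩ t ht
  obtain ⟨K, hK⟩ : ∃ K, K = ⨆ u : {u : ℝ // u ≤ s}, (|φ u.1| + |ψ u.1|) := ⟨_, rfl⟩
  rw [← hK]
  have hKb : ∀ u ≤ s, |φ u| + |ψ u| ≤ K := by
    intro u hu
    rw [hK]
    obtain ⟨C1, hC1⟩ := hφb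
    obtain ⟨C2, hC2⟩ := hψb
    refine le_ciSup (f := fun u : {u : ℝ // u ≤ s} => |φ u.1| + |ψ u.1|) ⟨C1 + C2, ?_⟩ ⟨u, hu⟩
    rintro _ ⟨v, rfl⟩
    exact add_le_add (hC1 _) (hC2 _)
  have hK0 : 0 ≤ K := le_trans (by positivity) (hKb s le_rfl)
  have hall : ∀ᵐ t : ℝ ∂volume, s ≤ t → (0 ≤ t - g t ∧ t - g t ≤ σ) ∧ (0 ≤ t - h t ∧ t - h t ≤ τ) ∧
      (a0 ≤ a t ∧ a t ≤ A0 ∧ b0 ≤ b t ∧ b t ≤ B0) ∧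
      deriv x t = a t * Dfun x ψ s (g t) - b t * x (h t) := by
    filter_upwards [hgdel, hhdel, hae, hx4] with t q1 q2 q3 q4 hst
    refine ⟨q1 (hs.trans hst), q2 (hs.trans hst), q3 (hs.trans hst), ?_⟩
    have := q4 hst
    have e : Dfun x ψ s t = deriv x t := by simp [Dfun, hst]
    rw [e] at this
    linarith
  have hcr := crude a b g h ψ x s r A0 B0 K hr0 hA0 hA0' hB0 hx2 hx3
    (fun t ht => by rw [hx1 t ht]; linarith [hKb t ht, abs_nonneg (ψ t)])
    (fun t ht => by linarith [hKb t ht, abs_nonneg (φ t)]) (by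
      filter_upwards [hall] with t q hst
      obtain ⟨q1, q2, q3, q4⟩ := q hst
      exact ⟨by linarith, by linarith, ⟨ha0.trans q3.1, q3.2.1, hb0.le.trans q3.2.2.1, q3.2.2.2⟩, q4⟩)
  rw [← hCc] at hcr
  have hw : ∀ t ∈ Set.Icc s (s + r), exp (γ * (t - s)) ≤ exp (γ * r) := by
    intro t ht
    apply exp_le_exp.2
    nlinarith [ht.2]
  obtain ⟨C, hC⟩ := hx3 (t + r + 1) (by linarith)
  have hmain := main_bound a b g h x s r (t + r + 1) σ τ a0 A0 b0 B0 lo hi γ C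
    (exp (γ * r) * (Cc * K)) τ' k1 D c2 θ hr0 (by linarith) hσ hτ hγ ha0 hA0 hb0 hB0 hlo hhi hlo0
    hlohi (by positivity) hρ hτ' hk1 hD hc2 hθ hθ0 hc.le (fun t ht => hx2 t ht.1) hC
    (fun t ht => mul_le_mul (hw t ht) (hcr t ht).1 (abs_nonneg _) (exp_pos _).le)
    (fun t ht => mul_le_mul (hw t ht) (hcr t ht).2 (abs_nonneg _) (exp_pos _).le) (by
      filter_upwards [hall] with t q hm
      have hst : s ≤ t := by linarith [hm.1]
      obtain ⟨q1, q2, q3, q4⟩ := q hst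
      have hm1 := hm.1
      have hsg : s ≤ g t := by linarith [q1.2]
      refine ⟨⟨hsg, by linarith, q1.2⟩, ⟨by linarith [q2.2], by linarith, q2.2⟩, q3, ?_⟩
      rw [q4]
      simp [Dfun, hsg]) t ⟨ht, by linarith⟩
  have hfin : |x t| = exp (-γ * (t - s)) * (exp (γ * (t - s)) * |x t|) := by
    rw [← mul_assoc, ← exp_add]; ring_nf; simp
  rw [hfin]
  refine (mul_le_mul_of_nonneg_left hmain (exp_pos _).le).trans (le_of_eq ?_)
  rw [hM]; ring
end

section
/- Let t0 ≥ 0, m ≥ 1, σ > 0, τ_1,…,τ_m > 0, and let a, b_1,…,b_m, g, h_1,…,h_m : ℝ → ℝ be Lebesgue measurable with 0 ≤ t − g(t) ≤ σ and 0 ≤ t − h_k(t) ≤ τ_k for almost every t ≥ t0. Suppose there exist constants α > 0, A0 ∈ [0,1), B_1,…,B_m ≥ 0, P ≥ 0 and Q_1,…,Q_m ≥ 0 such that for almost every t ≥ t0: b(t) := ∑_{k=1}^m b_k(t) ≥ α, |a(t)| ≤ A0, |b_k(t)| ≤ B_k, |a(t)|/b(t) ≤ P and |b_k(t)|/b(t)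 ≤ Q_k, and that ((∑_{k=1}^m B_k)/(1 − A0)) · (P + ∑_{k=1}^m τ_k·Q_k) < 1. Then there exist constants λ > 0, α' > 0, P' ≥ 0 and Q'_1,…,Q'_m ≥ 0 such that for almost every t ≥ t0: e^{λσ}·A0 < 1; p(t) := ∑_{k=1}^m e^{λ(t−h_k(t))}·b_k(t) + λ·a(t)·e^{λ(t−g(t))} − λ ≥ α'; |a(t)|/p(t) ≤ P'; |b_k(t)|/p(t) ≤ Q'_k; and ((λ + ∑_{k=1}^m e^{λτ_k}·B_k + λ·e^{λσ}·A0)/(1 − e^{λσ}·A0)) · (P'·(1+λσ)·e^{λσ} + ∑_{k=1}^m Q'_k·e^{λτ_k}·τ_k) < 1. -/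
open MeasureTheory Real

set_option maxHeartbeats 2000000 in
/-- The continuity-in-λ argument deducing Theorem 4.2 from Theorem 4.1: the
delay-independent condition of Theorem 4.2 yields a positive exponent `λ` for
which conditions (4.1) and (4.2) of Theorem 4.1 hold. -/
theorem existence_of_exponent
    (t0 : ℝ) (ht0 : 0 ≤ t0) (m : ℕ) (hm : 1 ≤ m)
    (σ : ℝ) (hσ : 0 < σ) (τ : Fin m → ℝ) (hτ : ∀ k, 0 < τ k)
    (a g : ℝ → ℝ) (b h : Fin m → ℝ → ℝ)
    (ham : Measurable a) (hgm : Measurable g)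
    (hbm : ∀ k, Measurable (b k)) (hhm : ∀ k, Measurable (h k))
    (hgdel : ∀ᵐ t : ℝ ∂volume, t0 ≤ t → 0 ≤ t - g t ∧ t - g t ≤ σ)
    (hhdel : ∀ᵐ t : ℝ ∂volume, t0 ≤ t → ∀ k, 0 ≤ t - h k t ∧ t - h k t ≤ τ k)
    (α A0 : ℝ) (B : Fin m → ℝ) (P : ℝ) (Q : Fin m → ℝ)
    (hα : 0 < α) (hA0 : 0 ≤ A0) (hA0' : A0 < 1)
    (hB : ∀ k, 0 ≤ B k) (hP : 0 ≤ P) (hQ : ∀ k, 0 ≤ Q k)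
    (hae : ∀ᵐ t : ℝ ∂volume, t0 ≤ t →
      α ≤ ∑ k, b k t ∧ |a t| ≤ A0 ∧ (∀ k, |b k t| ≤ B k) ∧
      |a t| / (∑ k, b k t) ≤ P ∧ (∀ k, |b k t| / (∑ k, b k t) ≤ Q k))
    (hcond : ((∑ k, B k) / (1 - A0)) * (P + ∑ k, τ k * Q k) < 1) :
    ∃ lam : ℝ, 0 < lam ∧ ∃ α' : ℝ, 0 < α' ∧ ∃ P' : ℝ, 0 ≤ P' ∧
      ∃ Q' : Fin m → ℝ, (∀ k, 0 ≤ Q' k) ∧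
      Real.exp (lam * σ) * A0 < 1 ∧
      (∀ᵐ t : ℝ ∂volume, t0 ≤ t →
        α' ≤ (∑ k, Real.exp (lam * (t - h k t)) * b k t) +
            lam * a t * Real.exp (lam * (t - g t)) - lam ∧
        |a t| / ((∑ k, Real.exp (lam * (t - h k t)) * b k t) +
            lam * a t * Real.exp (lam * (t - g t)) - lam) ≤ P' ∧
        (∀ k, |b k t| / ((∑ k, Real.exp (lam * (t - h k t)) * b k t) +
            lam * a t * Real.exp (lam * (t - g t)) - lam) ≤ Q' k)) ∧
      ((lam + (∑ k, Real.exp (lam * τ k) * B k) + lam * Real.exp (lam * σ) * A0) /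
          (1 - Real.exp (lam * σ) * A0)) *
        (P' * (1 + lam * σ) * Real.exp (lam * σ) +
          ∑ k, Q' k * Real.exp (lam * τ k) * τ k) < 1 := by
  classical
  set E : ℝ → ℝ := fun l =>
    (∑ k, (Real.exp (l * τ k) - 1) * B k) + l * A0 * Real.exp (l * σ) + l with hE
  have hEc : Continuous E := by rw [hE]; fun_prop
  have hE0 : E 0 = 0 := by simp [hE]
  set θ : ℝ → ℝ := fun l => 1 - E l / α with hθ
  have hθc : Continuous θ := by rw [hθ]; fun_prop
  have hθ0 : θ 0 = 1 := by simp [hθ, hE0]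
  set F : ℝ → ℝ := fun l =>
    ((l + (∑ k, Real.exp (l * τ k) * B k) + l * Real.exp (l * σ) * A0) /
          (1 - Real.exp (l * σ) * A0)) *
        (P / θ l * (1 + l * σ) * Real.exp (l * σ) +
          ∑ k, Q k / θ l * Real.exp (l * τ k) * τ k) with hF
  have hF0 : F 0 < 1 := by
    have : F 0 = ((∑ k, B k) / (1 - A0)) * (P + ∑ k, τ k * Q k) := by
      simp [hF, hθ0, mul_comm]
    rw [this]; exact hcond
  have hFc : ContinuousAt F 0 := by
    have h1 : ContinuousAt θ 0 := hθc.continuousAt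
    have h2 : θ 0 ≠ 0 := by rw [hθ0]; norm_num
    have h3 : ∀ c : ℝ, ContinuousAt (fun l => c / θ l) 0 := fun c =>
      continuousAt_const.div h1 h2
    have h4 : ContinuousAt (fun l => P / θ l * (1 + l * σ) * Real.exp (l * σ) +
          ∑ k, Q k / θ l * Real.exp (l * τ k) * τ k) 0 := by
      refine ContinuousAt.add (((h3 P).mul (by fun_prop)).mul (by fun_prop)) ?_
      refine tendsto_finsetSum _ fun k _ => ?_
      exact ((h3 (Q k)).mul (g := fun l => Real.exp (l * τ k)) (by fun_prop)).mul
        (g := fun _ => τ k) (by fun_prop)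
    refine ContinuousAt.mul (ContinuousAt.div (by fun_prop) (by fun_prop) ?_) h4
    simp; linarith
  have e1 : ∀ᶠ l in nhds (0 : ℝ), F l < 1 := hFc.eventually_lt continuousAt_const hF0
  have e2 : ∀ᶠ l in nhds (0 : ℝ), 0 < θ l :=
    continuousAt_const.eventually_lt hθc.continuousAt (by rw [hθ0]; norm_num)
  have e3 : ∀ᶠ l in nhds (0 : ℝ), Real.exp (l * σ) * A0 < 1 :=
    ContinuousAt.eventually_lt (f := fun l : ℝ => Real.exp (l * σ) * A0) (by fun_prop)
      continuousAt_const (by simpa using hA0')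
  have e4 : ∀ᶠ l in nhdsWithin (0 : ℝ) (Set.Ioi 0), 0 < l := eventually_mem_nhdsWithin
  obtain ⟨l, ⟨⟨h1, h2⟩, h3⟩, hl⟩ :=
    ((((e1.and e2).and e3).filter_mono nhdsWithin_le_nhds).and e4).exists
  refine ⟨l, hl, α * θ l, mul_pos hα h2, P / θ l, div_nonneg hP h2.le, fun k => Q k / θ l,
    fun k => div_nonneg (hQ k) h2.le, h3, ?_, h1⟩
  filter_upwards [hgdel, hhdel, hae] with t hg hh hab ht
  have hg := hg ht
  have hh := hh ht
  obtain ⟨hb, ha, hbk, haP, hbQ⟩ := hab ht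
  set S := ∑ k, b k t with hS
  set p := (∑ k, Real.exp (l * (t - h k t)) * b k t) +
            l * a t * Real.exp (l * (t - g t)) - l with hp
  have hSpos : 0 < S := hα.trans_le hb
  have hpE : S - E l ≤ p := by
    have s1 : S - ∑ k, (Real.exp (l * τ k) - 1) * B k
        ≤ ∑ k, Real.exp (l * (t - h k t)) * b k t := by
      rw [hS, ← Finset.sum_sub_distrib]
      refine Finset.sum_le_sum fun k _ => ?_
      have u1 : 1 ≤ Real.exp (l * (t - h k t)) :=
        Real.one_le_exp (mul_nonneg hl.le (hh k).1)
      have u2 : Real.exp (l * (t - h k t)) ≤ Real.exp (l * τ k) :=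
        Real.exp_le_exp.2 (mul_le_mul_of_nonneg_left (hh k).2 hl.le)
      have u3 := (abs_le.1 (hbk k)).1
      have u4 := hB k
      nlinarith [mul_nonneg (sub_nonneg.2 u1) (by linarith : 0 ≤ b k t + B k),
        mul_nonneg (sub_nonneg.2 u2) u4]
    have s2 : -(l * A0 * Real.exp (l * σ)) ≤ l * a t * Real.exp (l * (t - g t)) := by
      have u2 : Real.exp (l * (t - g t)) ≤ Real.exp (l * σ) :=
        Real.exp_le_exp.2 (mul_le_mul_of_nonneg_left hg.2 hl.le)
      have u0 := Real.exp_pos (l * (t - g t))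
      have u3 := (abs_le.1 ha).1
      have u5 : -(A0 * Real.exp (l * σ)) ≤ a t * Real.exp (l * (t - g t)) := by
        nlinarith [mul_nonneg u0.le (by linarith : 0 ≤ a t + A0),
          mul_nonneg (sub_nonneg.2 u2) hA0]
      nlinarith [mul_le_mul_of_nonneg_left u5 hl.le]
    simp only [hE, hp]
    linarith
  have hEn : 0 ≤ E l := by
    have : 0 ≤ ∑ k, (Real.exp (l * τ k) - 1) * B k :=
      Finset.sum_nonneg fun k _ => mul_nonneg
        (sub_nonneg.2 (Real.one_le_exp (mul_nonneg hl.le (hτ k).le))) (hB k)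
    have h6 : 0 ≤ l * A0 * Real.exp (l * σ) :=
      mul_nonneg (mul_nonneg hl.le hA0) (Real.exp_pos _).le
    exact add_nonneg (add_nonneg this h6) hl.le
  have hpS : S * θ l ≤ p := by
    have : E l ≤ S * (E l / α) := by
      rw [mul_div_assoc', le_div_iff₀ hα]
      nlinarith
    have h5 : S * θ l = S - S * (E l / α) := by simp only [hθ]; ring
    linarith
  have hSθ : 0 < S * θ l := mul_pos hSpos h2
  have key : ∀ x R : ℝ, 0 ≤ x → x / S ≤ R → x / p ≤ R / θ l := fun x R hx hR => by
    calc x / p ≤ x / (S * θ l) := div_le_div_of_nonneg_left hx hSθ hpS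
      _ = x / S / θ l := by rw [div_div]
      _ ≤ R / θ l := div_le_div_of_nonneg_right hR h2.le
  exact ⟨(mul_le_mul_of_nonneg_right hb h2.le).trans hpS, key _ _ (abs_nonneg _) haP,
    fun k => key _ _ (abs_nonneg _) (hbQ k)⟩
end

section
/- For every σ > 0, the neutral equation x'(t) − 0.15·x'(t − σ) = −x(t − 1/e − 0.1·sin t), t ≥ 0, is uniformly exponentially stable for initial times in [0,∞); that is, there exist M > 0 and γ > 0 such that for every s ≥ 0, all bounded φ, ψ : ℝ → ℝ, and every solution x on [s,∞) with initial data (φ,ψ), one has |x(t)| ≤ M·e^{−γ(t−s)}·sup_{u≤s}(|φ(u)| + |ψ(u)|) for all t ≥ s. -/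
open MeasureTheory Real

/-- A differentiable function with bounded derivative whose derivative is a.e. dominated. -/
lemma ftc_bound (G Φ Φ' : ℝ → ℝ) (a b C : ℝ) (hab : a ≤ b)
    (hG : ∀ t ∈ Set.Icc a b, DifferentiableAt ℝ G t)
    (hC : ∀ t ∈ Set.Icc a b, |deriv G t| ≤ C)
    (hΦ : ∀ t, HasDerivAt Φ (Φ' t) t) (hc : Continuous Φ')
    (hae : ∀ᵐ t : ℝ ∂volume, t ∈ Set.Icc a b → |deriv G t| ≤ Φ' t) :
    |G b - G a| ≤ Φ b - Φ a := by
  have hint : IntervalIntegrable (deriv G) volume a b := by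
    rw [intervalIntegrable_iff_integrableOn_Ioc_of_le hab]
    refine Measure.integrableOn_of_bounded (M := C) (by simp)
      (measurable_deriv G).aestronglyMeasurable ?_
    rw [ae_restrict_iff' measurableSet_Ioc]
    exact Filter.Eventually.of_forall fun t ht => hC t ⟨ht.1.le, ht.2⟩
  have h1 : ∫ t in a..b, deriv G t = G b - G a := by
    apply intervalIntegral.integral_eq_sub_of_hasDerivAt _ hint
    intro t ht
    rw [Set.uIcc_of_le hab] at ht
    exact (hG t ht).hasDerivAt
  have h2 : ∫ t in a..b, Φ' t = Φ b - Φ a :=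
    intervalIntegral.integral_eq_sub_of_hasDerivAt (fun t _ => hΦ t) (hc.intervalIntegrable _ _)
  rw [← h1, ← h2]
  have := intervalIntegral.norm_integral_le_of_norm_le (μ := volume) (f := deriv G) (g := Φ') hab
    (by filter_upwards [hae] with t ht hm using ht ⟨hm.1.le, hm.2⟩)
    (hc.intervalIntegrable _ _)
  simpa using this

lemma exp_small : Real.exp (0.04:ℝ) ≤ 1.05 := by
  have h := Real.add_one_le_exp (-0.04:ℝ)
  have h2 : Real.exp (0.04:ℝ) * Real.exp (-0.04:ℝ) = 1 := by rw [← Real.exp_add]; norm_num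
  have := Real.exp_pos (0.04:ℝ)
  nlinarith

lemma delay_bounds (t : ℝ) : 0 ≤ 1 / Real.exp 1 + 0.1 * Real.sin t ∧
    1 / Real.exp 1 + 0.1 * Real.sin t ≤ 0.47 := by
  have h1 := Real.exp_one_gt_d9
  have h2 := Real.exp_one_lt_d9
  have h3 := Real.sin_le_one t
  have h4 := Real.neg_one_le_sin t
  have h5 : 1 / Real.exp 1 ≤ 0.37 := by
    rw [div_le_iff₀ (Real.exp_pos 1)]; linarith
  have h6 : 0.3 ≤ 1 / Real.exp 1 := by
    rw [le_div_iff₀ (Real.exp_pos 1)]; linarith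
  constructor <;> linarith

lemma key (σ γ s K A T : ℝ) (φ ψ x : ℝ → ℝ) (hσ : 0 < σ) (hγ : 0 < γ) (hγ1 : γ ≤ 0.04)
    (hγσ : γ * (σ + 1) = 0.04)
    (hK : ∀ u, u ≤ s → |φ u| + |ψ u| ≤ K)
    (hx : IsNeutralSolution1 (fun _ => 0.15) (fun _ => 1) (fun t => t - σ)
      (fun t => t - 1 / Real.exp 1 - 0.1 * Real.sin t) s φ ψ x)
    (hKA : K ≤ A) (hA : ∀ t ∈ Set.Icc s T, |x t| ≤ A * Real.exp (-γ * (t - s))) :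
    ∀ t ∈ Set.Icc s T, |x t| ≤ (0.85 * A + 3.2 * K) * Real.exp (-γ * (t - s)) := by
  obtain ⟨hφ, hdiff, hbd, hae⟩ := hx
  have hK0 : 0 ≤ K := le_trans (by positivity) (hK s le_rfl)
  have hA0 : 0 ≤ A := hK0.trans hKA
  have hφK : ∀ u, u ≤ s → |φ u| ≤ K := fun u hu => by
    have := hK u hu; have := abs_nonneg (ψ u); linarith
  have hψK : ∀ u, u ≤ s → |ψ u| ≤ K := fun u hu => by
    have := hK u hu; have := abs_nonneg (φ u); linarith
  set w : ℝ → ℝ := fun t => Real.exp (-γ * (t - s)) with hw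
  have hwpos : ∀ t, 0 < w t := fun t => Real.exp_pos _
  have hwge : ∀ t, t ≤ s → 1 ≤ w t := fun t ht => Real.one_le_exp (by nlinarith)
  have hanti : ∀ u t, u ≤ t → w t ≤ w u := fun u t h => Real.exp_le_exp.2 (by nlinarith)
  have hshift : ∀ t d, d ≤ σ + 1 → w (t - d) ≤ 1.05 * w t := by
    intro t d hd
    have : w (t - d) = Real.exp (γ * d) * w t := by
      simp only [hw]; rw [← Real.exp_add]; congr 1; ring
    rw [this]
    have h2 : Real.exp (γ * d) ≤ Real.exp 0.04 := Real.exp_le_exp.2 (by nlinarith)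
    exact mul_le_mul_of_nonneg_right (h2.trans exp_small) (hwpos t).le
  -- global bound on x up to T
  have hX : ∀ u, u ≤ T → |x u| ≤ A * w u := by
    intro u hu
    rcases le_total s u with h | h
    · exact hA u ⟨h, hu⟩
    · rw [hφ u h]; nlinarith [hφK u h, hwge u h]
  -- a.e. bound on the derivative
  have hDn : ∀ n : ℕ, ∀ᵐ t : ℝ ∂volume, t ≤ T → t < s + n * σ →
      |Dfun x ψ s t| ≤ 1.25 * A * w t := by
    intro n
    induction n with
    | zero =>
      refine Filter.Eventually.of_forall fun t _ ht => ?_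
      have ht' : t < s := by simpa using ht
      simp only [Dfun, if_neg (not_le.2 ht')]
      nlinarith [hψK t ht'.le, hwge t ht'.le]
    | succ n ih =>
      have ih' := (measurePreserving_sub_right (volume : Measure ℝ) σ).quasiMeasurePreserving.ae ih
      filter_upwards [ih', hae] with t h1 h2 hT hn
      rcases lt_or_ge t s with ht' | ht'
      · simp only [Dfun, if_neg (not_le.2 ht')]
        nlinarith [hψK t ht'.le, hwge t ht'.le]
      · have e := h2 ht'
        have b1 := h1 (by linarith) (by push_cast at hn; linarith)
        obtain ⟨d0, d1⟩ := delay_bounds t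
        have b2 := hX (t - 1 / Real.exp 1 - 0.1 * Real.sin t) (by linarith)
        have b3 := hshift t (1 / Real.exp 1 + 0.1 * Real.sin t) (by linarith)
        have b4 := hshift t σ (by linarith)
        rw [show t - (1 / Real.exp 1 + 0.1 * Real.sin t) =
          t - 1 / Real.exp 1 - 0.1 * Real.sin t by ring] at b3
        have e' : Dfun x ψ s t = 0.15 * Dfun x ψ s (t - σ)
          - x (t - 1 / Real.exp 1 - 0.1 * Real.sin t) := by
          linarith
        have c1 : |Dfun x ψ s (t - σ)| ≤ 1.25 * A * (1.05 * w t) :=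
          b1.trans (mul_le_mul_of_nonneg_left b4 (by positivity))
        have c2 : |x (t - 1 / Real.exp 1 - 0.1 * Real.sin t)| ≤ A * (1.05 * w t) :=
          b2.trans (mul_le_mul_of_nonneg_left b3 hA0)
        have hp : 0 ≤ A * w t := mul_nonneg hA0 (hwpos t).le
        rw [e']
        rw [abs_le] at *
        constructor <;> linarith [c1.1, c1.2, c2.1, c2.2]
  have hD : ∀ᵐ t : ℝ ∂volume, t ≤ T → |Dfun x ψ s t| ≤ 1.25 * A * w t := by
    filter_upwards [ae_all_iff.2 hDn] with t ht hT
    obtain ⟨n, hn⟩ := exists_nat_gt ((t - s) / σ)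
    rw [div_lt_iff₀ hσ] at hn
    exact ht n hT (by linarith)
  -- increments of x
  have hinc : ∀ u t, s ≤ u → u ≤ t → t ≤ T → t - u ≤ 0.47 →
      |x t - x u| ≤ 0.47 * (1.25 * A * (1.05 * w t)) := by
    intro u t hu hut htT hd
    obtain ⟨C, hC⟩ := hbd t (hu.trans hut)
    set L := 1.25 * A * (1.05 * w t) with hL
    have hL0 : 0 ≤ L := by have := hwpos t; positivity
    have := ftc_bound x (fun v => L * v) (fun _ => L) u t C hut
      (fun v hv => hdiff v (hu.trans hv.1)) (fun v hv => hC v ⟨hu.trans hv.1, hv.2⟩)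
      (fun v => by simpa using (hasDerivAt_id v).const_mul L) continuous_const
      (by
        filter_upwards [hD] with v hv hm
        have h1 := hv (hm.2.trans htT)
        simp only [Dfun, if_pos (hu.trans hm.1)] at h1
        refine h1.trans (mul_le_mul_of_nonneg_left ?_ (by positivity))
        exact (hanti (t - 0.47) v (by linarith [hm.1])).trans (hshift t 0.47 (by linarith)))
    refine this.trans ?_
    nlinarith
  -- forcing bound
  have hF : ∀ᵐ t : ℝ ∂volume, s ≤ t → t ≤ T →
      |deriv x t + x t| ≤ (0.816 * A + 2.1 * K) * w t := by
    have hD' := (measurePreserving_sub_right (volume : Measure ℝ) σ).quasiMeasurePreserving.ae hD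
    filter_upwards [hD', hae] with t h1 h2 hs hT
    have e := h2 hs
    have b1 := h1 (by linarith)
    have b4 := hshift t σ (by linarith)
    obtain ⟨d0, d1⟩ := delay_bounds t
    have c1 : |Dfun x ψ s (t - σ)| ≤ 1.25 * A * (1.05 * w t) :=
      b1.trans (mul_le_mul_of_nonneg_left b4 (by positivity))
    have e' : deriv x t + x t = 0.15 * Dfun x ψ s (t - σ)
          + (x t - x (t - 1 / Real.exp 1 - 0.1 * Real.sin t)) := by
      have : Dfun x ψ s t = deriv x t := by simp only [Dfun, if_pos hs]
      rw [this] at e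
      linarith
    have hp : 0 ≤ A * w t := mul_nonneg hA0 (hwpos t).le
    have hKw : 0 ≤ K * w t := mul_nonneg hK0 (hwpos t).le
    have c2 : |x t - x (t - 1 / Real.exp 1 - 0.1 * Real.sin t)| ≤
        0.47 * (1.25 * A * (1.05 * w t)) + 2.1 * K * w t := by
      rcases le_total s (t - 1 / Real.exp 1 - 0.1 * Real.sin t) with h | h
      · have := hinc _ t h (by linarith) hT (by linarith)
        linarith
      · have i1 := hinc s t le_rfl hs hT (by linarith)
        have i2 := hφK _ h
        have i3 := hφK s le_rfl
        rw [← hφ _ h] at i2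
        rw [← hφ s le_rfl] at i3
        have i4 : 1 ≤ 1.05 * w t := by
          have := hshift t (t - s) (by linarith)
          exact (hwge _ (by linarith)).trans this
        have i5 : K ≤ K * (1.05 * w t) := le_mul_of_one_le_right hK0 i4
        rw [abs_le] at *
        constructor <;> linarith [i1.1, i1.2, i2.1, i2.2, i3.1, i3.2]
    rw [e']
    rw [abs_le] at *
    constructor <;> linarith [c1.1, c1.2, c2.1, c2.2]
  -- conclusion
  intro t ht
  set F := 0.816 * A + 2.1 * K with hFdef
  have hF0 : 0 ≤ F := by positivity
  obtain ⟨C, hC⟩ := hbd t ht.1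
  have hg1 : 0 < 1 - γ := by linarith
  have hderG : ∀ v, s ≤ v → HasDerivAt (fun v => Real.exp (v - s) * x v)
      (Real.exp (v - s) * (deriv x v + x v)) v := by
    intro v hv
    have h1 : HasDerivAt (fun v => Real.exp (v - s)) (Real.exp (v - s)) v := by
      simpa using ((hasDerivAt_id v).sub_const s).exp
    have := h1.mul (hdiff v hv).hasDerivAt
    exact this.congr_deriv (by ring)
  have main := ftc_bound (fun v => Real.exp (v - s) * x v)
    (fun v => F / (1 - γ) * Real.exp ((1 - γ) * (v - s)))
    (fun v => F * Real.exp ((1 - γ) * (v - s))) s t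
    (Real.exp (t - s) * (C + A)) ht.1
    (fun v hv => (hderG v hv.1).differentiableAt)
    (by
      intro v hv
      rw [(hderG v hv.1).deriv, abs_mul, abs_of_pos (Real.exp_pos _)]
      have h1 : Real.exp (v - s) ≤ Real.exp (t - s) := Real.exp_le_exp.2 (by linarith [hv.2])
      have h2 := hC v hv
      have h3 := hX v (hv.2.trans ht.2)
      have h4 : w v ≤ 1 := Real.exp_le_one_iff.2 (by nlinarith [hv.1])
      have h5 : |deriv x v + x v| ≤ C + A :=
        (abs_add_le _ _).trans (add_le_add h2 (h3.trans (mul_le_of_le_one_right hA0 h4)))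
      exact mul_le_mul h1 h5 (abs_nonneg _) (Real.exp_pos _).le)
    (by
      intro v
      have h1 : HasDerivAt (fun v => Real.exp ((1 - γ) * (v - s)))
          (Real.exp ((1 - γ) * (v - s)) * (1 - γ)) v := by
        simpa using (((hasDerivAt_id v).sub_const s).const_mul (1 - γ)).exp
      exact (h1.const_mul (F / (1 - γ))).congr_deriv (by field_simp))
    (by fun_prop)
    (by
      filter_upwards [hF] with v hv hm
      rw [(hderG v hm.1).deriv, abs_mul, abs_of_pos (Real.exp_pos _)]
      have := mul_le_mul_of_nonneg_left (hv hm.1 (hm.2.trans ht.2)) (Real.exp_pos (v - s)).le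
      refine this.trans (le_of_eq ?_)
      rw [show (1 - γ) * (v - s) = (v - s) + (-γ * (v - s)) by ring, Real.exp_add]
      simp only [hw]; ring)
  simp only [sub_self, Real.exp_zero, mul_zero, one_mul, mul_one] at main
  have hxs : |x s| ≤ K := by rw [hφ s le_rfl]; exact hφK s le_rfl
  have hFq : F / (1 - γ) ≤ 0.85 * A + 2.2 * K := by
    rw [div_le_iff₀ hg1]; nlinarith
  have hFq0 : 0 ≤ F / (1 - γ) := by positivity
  have hEt : Real.exp ((1 - γ) * (t - s)) = Real.exp (t - s) * w t := by
    rw [show (1 - γ) * (t - s) = (t - s) + (-γ * (t - s)) by ring, Real.exp_add]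
  rw [hEt] at main
  have hEw1 : 1 ≤ Real.exp (t - s) * w t := by
    rw [← hEt]; exact Real.one_le_exp (mul_nonneg hg1.le (by linarith [ht.1]))
  have h7 : Real.exp (t - s) * |x t| ≤ Real.exp (t - s) * ((0.85 * A + 3.2 * K) * w t) := by
    have h8 : Real.exp (t - s) * |x t| = |Real.exp (t - s) * x t| := by
      rw [abs_mul, abs_of_pos (Real.exp_pos _)]
    have h9 : |Real.exp (t - s) * x t| ≤ |Real.exp (t - s) * x t - x s| + |x s| := by
      simpa using abs_add_le (Real.exp (t - s) * x t - x s) (x s)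
    have h10 : K ≤ K * (Real.exp (t - s) * w t) := le_mul_of_one_le_right hK0 hEw1
    have h11 := mul_le_mul_of_nonneg_right hFq (zero_le_one.trans hEw1)
    rw [h8]
    linarith
  exact le_of_mul_le_mul_left h7 (Real.exp_pos _)

/-- Example 5.1: for every `σ > 0`, the equation
`x'(t) - 0.15 x'(t - σ) = -x(t - 1/e - 0.1 sin t)` is uniformly exponentially
stable for initial times in `[0, ∞)`. -/
theorem example5_1 : ∀ σ : ℝ, 0 < σ →
    UnifExpStable1 (fun _ => 0.15) (fun _ => 1) (fun t => t - σ)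
      (fun t => t - 1 / Real.exp 1 - 0.1 * Real.sin t) 0 := by
  intro σ hσ
  have hγ : 0 < 0.04 / (σ + 1) := by positivity
  have hγσ : 0.04 / (σ + 1) * (σ + 1) = 0.04 := by field_simp
  refine ⟨30, by norm_num, 0.04 / (σ + 1), hγ, ?_⟩
  set γ := 0.04 / (σ + 1) with hγdef
  have hγ1 : γ ≤ 0.04 := by nlinarith
  intro s _ φ ψ x hφb hψb hx T hT
  set K := ⨆ u : {u : ℝ // u ≤ s}, (|φ u.1| + |ψ u.1|) with hKdef
  have hK : ∀ u, u ≤ s → |φ u| + |ψ u| ≤ K := by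
    intro u hu
    obtain ⟨C1, h1⟩ := hφb
    obtain ⟨C2, h2⟩ := hψb
    have hb : BddAbove (Set.range fun u : {u : ℝ // u ≤ s} => |φ u.1| + |ψ u.1|) := by
      refine ⟨C1 + C2, ?_⟩
      rintro _ ⟨v, rfl⟩
      exact add_le_add (h1 _) (h2 _)
    exact le_ciSup hb ⟨u, hu⟩
  have hK0 : 0 ≤ K := le_trans (by positivity) (hK s le_rfl)
  have hcont : ContinuousOn (fun t => |x t| * Real.exp (γ * (t - s))) (Set.Icc s T) := by
    apply ContinuousOn.mul
    · exact ContinuousOn.abs fun t ht => (hx.2.1 t ht.1).continuousAt.continuousWithinAt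
    · fun_prop
  obtain ⟨m, hm, hmax⟩ := isCompact_Icc.exists_isMaxOn (Set.nonempty_Icc.2 hT) hcont
  set A0 := |x m| * Real.exp (γ * (m - s)) with hA0
  have hA00 : 0 ≤ A0 := by positivity
  have hee : ∀ t, Real.exp (γ * (t - s)) * Real.exp (-γ * (t - s)) = 1 := by
    intro t; rw [← Real.exp_add]; simp
  have hbound : ∀ t ∈ Set.Icc s T, |x t| ≤ A0 * Real.exp (-γ * (t - s)) := by
    intro t ht
    have h1 : |x t| * Real.exp (γ * (t - s)) ≤ A0 := hmax ht
    have h2 := mul_le_mul_of_nonneg_right h1 (Real.exp_pos (-γ * (t - s))).le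
    rwa [mul_assoc, hee, mul_one] at h2
  have hk := key σ γ s K (A0 + K) T φ ψ x hσ hγ hγ1 hγσ hK hx (by linarith)
    (fun t ht => (hbound t ht).trans
      (mul_le_mul_of_nonneg_right (by linarith) (Real.exp_pos _).le)) m hm
  have h3 := mul_le_mul_of_nonneg_right hk (Real.exp_pos (γ * (m - s))).le
  rw [mul_assoc, mul_comm (Real.exp (-γ * (m - s))), hee, mul_one, ← hA0] at h3
  have h4 : A0 ≤ 30 * K := by linarith
  have h5 := hbound T ⟨hT, le_rfl⟩
  have h6 := mul_le_mul_of_nonneg_right h4 (Real.exp_pos (-γ * (T - s))).le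
  linarith
end
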